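/- Let Φ : V₁ → V₂ be linear, σ an alternating bilinear form on V₁, E₁ ⊆ V₁ ⊕ V₁* a Lagrangian subspace, E₂ := (E₁)_{Φ,σ} its (Φ,σ)-forward image (so that (Φ,σ) : (V₁,E₁) → (V₂,E₂) is a Dirac morphism), and let F ⊆ V₂ ⊕ V₂* be a Lagrangian subspace transverse to E₂, i.e. F ∩ E₂ = 0 and F + E₂ = V₂ ⊕ V₂*. Then the following are equivalent: (1) the Dirac morphism (Φ,σ) is strong, i.e. ker(Φ,σ) ∩ E₁ = 0; (2) the Dirac morphism Φ : (V₁, (E₁)_σ) → (V₂, E₂) is strong, i.e. {(v, 0) : v ∈ V₁, Φ(v) = 0} ∩ (E₁)_σ = 0; (3) the (Φ,σ)-backward image F^{Φ,σ} is transverse to E₁, i.e. F^{Φ,σ} ∩ E₁ = 0 and F^{Φ,σ} + E₁ = V₁ ⊕ V₁* (a Lagrangian splitting); (4) the Φ-backward image F^{Φ} is transverse to the σ-forward image (E₁)_σ, i.e. F^{Φ} ∩ (E₁)_σ = 0 and F^{Φ} + (E₁)_σ = V₁ ⊕ V₁* (a Lagrangian splitting). -/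

import Mathlib

/-- A subset `S` of `V ⊕ V*` is Lagrangian when it coincides with its own orthogonal
complement with respect to the canonical split symmetric bilinear form
`⟨(v,α),(w,β)⟩ = α w + β v`. -/
def IsLagrangian {K V : Type*} [Field K] [AddCommGroup V] [Module K V]
    (S : Set (V × Module.Dual K V)) : Prop :=
  ∀ y : V × Module.Dual K V, y ∈ S ↔ ∀ x ∈ S, x.2 y.1 + y.2 x.1 = 0

/-- A Lagrangian subset, bundled as a submodule. -/
def IsLagrangian.toSubmodule {K V : Type*} [Field K] [AddCommGroup V] [Module K V]
    {S : Set (V × Module.Dual K V)} (hS : IsLagrangian S) :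
    Submodule K (V × Module.Dual K V) where
  carrier := S
  zero_mem' := (hS 0).2 fun x _ => by simp
  add_mem' {a b} ha hb := (hS _).2 fun x hx => by
    have h₁ := (hS a).1 ha x hx
    have h₂ := (hS b).1 hb x hx
    simp only [Prod.fst_add, Prod.snd_add, map_add, LinearMap.add_apply]
    linear_combination h₁ + h₂
  smul_mem' c a ha := (hS _).2 fun x hx => by
    have h := (hS a).1 ha x hx
    simp only [Prod.smul_fst, Prod.smul_snd, map_smul, LinearMap.smul_apply, smul_eq_mul]
    linear_combination c * h

/-- If the kernel of `(Φ, σ)` meets a Lagrangian subspace `E` trivially, then every covector is the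
sum of a covector pulled back along `Φ` and one of the form `α + σ u` with `(u, α) ∈ E`. -/
theorem IsLagrangian.exists_eq_add_dualMap {K V₁ V₂ : Type*} [Field K]
    [AddCommGroup V₁] [Module K V₁] [FiniteDimensional K V₁]
    [AddCommGroup V₂] [Module K V₂]
    {Φ : V₁ →ₗ[K] V₂} {σ : V₁ →ₗ[K] Module.Dual K V₁} (halt : ∀ v : V₁, σ v v = 0)
    {E : Set (V₁ × Module.Dual K V₁)} (hE : IsLagrangian E)
    (hker : ∀ v, Φ v = 0 → (v, -σ v) ∈ E → v = 0) (α : Module.Dual K V₁) :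
    ∃ p ∈ E, ∃ β : Module.Dual K V₂, α = p.2 + σ p.1 + Φ.dualMap β := by
  let L : V₁ × Module.Dual K V₁ →ₗ[K] Module.Dual K V₁ :=
    LinearMap.snd K V₁ (Module.Dual K V₁) + σ.comp (LinearMap.fst K V₁ (Module.Dual K V₁))
  have htop : hE.toSubmodule.map L ⊔ LinearMap.range Φ.dualMap = ⊤ := by
    rw [← Subspace.dualCoannihilator_dualAnnihilator_eq
      (W := hE.toSubmodule.map L ⊔ LinearMap.range Φ.dualMap)]
    suffices h : (hE.toSubmodule.map L ⊔ LinearMap.range Φ.dualMap).dualCoannihilator = ⊥ by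
      rw [h, Submodule.dualAnnihilator_bot]
    rw [eq_bot_iff]
    intro v hv
    rw [Submodule.mem_dualCoannihilator] at hv
    refine (Submodule.mem_bot K).2 (hker v ?_ ?_)
    · rw [← Module.forall_dual_apply_eq_zero_iff K]
      exact fun β => hv _ (Submodule.mem_sup_right ⟨β, rfl⟩)
    · refine (hE _).2 fun x hx => ?_
      have h : x.2 v + σ x.1 v = 0 := hv _ (Submodule.mem_sup_left ⟨x, hx, rfl⟩)
      have hneg : -σ v x.1 = σ x.1 v := LinearMap.IsAlt.neg (B := σ) halt v x.1
      simpa [hneg] using h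
  obtain ⟨_, ⟨p, hp, rfl⟩, _, ⟨β, rfl⟩, h⟩ :=
    Submodule.mem_sup.1 (htop ▸ Submodule.mem_top : α ∈ _)
  exact ⟨p, hp, β, h.symm⟩

/-- for a Dirac morphism `(Φ,σ) : (V₁,E₁) → (V₂,E₂)` and a Lagrangian
subspace `F` transverse to `E₂`, the following are equivalent: (1) `(Φ,σ)` is strong;
(2) `Φ : (V₁,(E₁)_σ) → (V₂,E₂)` is strong; (3) the `(Φ,σ)`-backward image of `F` is
transverse to `E₁`; (4) the `Φ`-backward image of `F` is transverse to `(E₁)_σ`. -/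
theorem statement7 (K V₁ V₂ : Type*) [Field K]
    [AddCommGroup V₁] [Module K V₁] [FiniteDimensional K V₁]
    [AddCommGroup V₂] [Module K V₂] [FiniteDimensional K V₂]
    (Φ : V₁ →ₗ[K] V₂) (σ : V₁ →ₗ[K] Module.Dual K V₁) (halt : ∀ v : V₁, σ v v = 0)
    (E₁ : Set (V₁ × Module.Dual K V₁)) (hE₁ : IsLagrangian E₁)
    (E₂ : Set (V₂ × Module.Dual K V₂))
    (hE₂ : E₂ = {p : V₂ × Module.Dual K V₂ |
      ∃ (v : V₁) (β : Module.Dual K V₂), p = (Φ v, β) ∧ (v, Φ.dualMap β - σ v) ∈ E₁})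
    (F : Set (V₂ × Module.Dual K V₂)) (hF : IsLagrangian F)
    (hFE₂inf : F ∩ E₂ = {0})
    (hFE₂sup : ∀ z : V₂ × Module.Dual K V₂, ∃ x ∈ F, ∃ y ∈ E₂, z = x + y) :
    [({p : V₁ × Module.Dual K V₁ | ∃ v : V₁, p = (v, - σ v) ∧ Φ v = 0} ∩ E₁ = {0}),
     ({p : V₁ × Module.Dual K V₁ | p.2 = 0 ∧ Φ p.1 = 0} ∩
        {p : V₁ × Module.Dual K V₁ | (p.1, p.2 - σ p.1) ∈ E₁} = {0}),
     (({p : V₁ × Module.Dual K V₁ | ∃ (v : V₁) (β : Module.Dual K V₂),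
          p = (v, Φ.dualMap β - σ v) ∧ (Φ v, β) ∈ F} ∩ E₁ = {0}) ∧
      (∀ z : V₁ × Module.Dual K V₁,
        ∃ x ∈ {p : V₁ × Module.Dual K V₁ | ∃ (v : V₁) (β : Module.Dual K V₂),
          p = (v, Φ.dualMap β - σ v) ∧ (Φ v, β) ∈ F},
        ∃ y ∈ E₁, z = x + y)),
     (({p : V₁ × Module.Dual K V₁ | ∃ (v : V₁) (β : Module.Dual K V₂),
          p = (v, Φ.dualMap β) ∧ (Φ v, β) ∈ F} ∩
        {p : V₁ × Module.Dual K V₁ | (p.1, p.2 - σ p.1) ∈ E₁} = {0}) ∧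
      (∀ z : V₁ × Module.Dual K V₁,
        ∃ x ∈ {p : V₁ × Module.Dual K V₁ | ∃ (v : V₁) (β : Module.Dual K V₂),
          p = (v, Φ.dualMap β) ∧ (Φ v, β) ∈ F},
        ∃ y ∈ {p : V₁ × Module.Dual K V₁ | (p.1, p.2 - σ p.1) ∈ E₁}, z = x + y))].TFAE := by
  subst hE₂
  have h0 : (0 : V₁ × Module.Dual K V₁) ∈ E₁ := hE₁.toSubmodule.zero_mem
  have hF0 : (0 : V₂ × Module.Dual K V₂) ∈ F := hF.toSubmodule.zero_mem
  tfae_have 1 ↔ 2 := by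
    simp only [Set.eq_singleton_iff_unique_mem]
    refine ⟨fun h => ⟨⟨by simp, by simpa [← Prod.zero_eq_mk] using h0⟩, ?_⟩,
      fun h => ⟨⟨⟨0, by simp [← Prod.zero_eq_mk]⟩, h0⟩, ?_⟩⟩
    · rintro ⟨v, _⟩ ⟨⟨rfl, hv⟩, hE⟩
      have := h.2 (v, -σ v) ⟨⟨v, rfl, hv⟩, by simpa using hE⟩
      exact Prod.ext (Prod.ext_iff.1 this).1 rfl
    · rintro _ ⟨⟨v, rfl, hv⟩, hE⟩
      have hv0 : v = 0 := (Prod.ext_iff.1 (h.2 (v, 0) ⟨⟨rfl, hv⟩, by simpa using hE⟩)).1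
      simp [hv0]
  tfae_have 3 → 1 := by
    rintro ⟨h, -⟩
    rw [Set.eq_singleton_iff_unique_mem] at h ⊢
    refine ⟨⟨⟨0, by simp [← Prod.zero_eq_mk]⟩, h0⟩, ?_⟩
    rintro _ ⟨⟨v, rfl, hv⟩, hE⟩
    exact h.2 _ ⟨⟨v, 0, by simp, by rw [hv]; exact hF0⟩, hE⟩
  tfae_have 1 → 3 := by
    intro h
    rw [Set.eq_singleton_iff_unique_mem] at h hFE₂inf
    refine ⟨Set.eq_singleton_iff_unique_mem.2
      ⟨⟨⟨0, 0, by simp [← Prod.zero_eq_mk], by rw [map_zero]; exact hF0⟩, h0⟩, ?_⟩, ?_⟩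
    · rintro _ ⟨⟨v, β, rfl, hvF⟩, hE⟩
      obtain ⟨hv, rfl⟩ := Prod.ext_iff.1 (hFE₂inf.2 (Φ v, β) ⟨hvF, v, β, rfl, hE⟩)
      exact h.2 _ ⟨⟨v, by simp, hv⟩, hE⟩
    · rintro ⟨a, α⟩
      obtain ⟨⟨u, γ⟩, hp, b, hb⟩ := hE₁.exists_eq_add_dualMap (Φ := Φ) halt
        (fun v hv hE => (Prod.ext_iff.1 (h.2 _ ⟨⟨v, rfl, hv⟩, hE⟩)).1) (α + σ a)
      obtain ⟨f, hf, _, ⟨v, β, rfl, hE⟩, hfe⟩ := hFE₂sup (Φ (a - u), b)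
      have hf' : f = (Φ (a - u - v), b - β) := by
        rw [eq_sub_of_add_eq hfe.symm]
        simp
      refine ⟨_, ⟨a - u - v, b - β, rfl, hf' ▸ hf⟩, _, hE₁.toSubmodule.add_mem hp hE, ?_⟩
      refine Prod.ext (by simp) ?_
      simp only [Prod.snd_add, map_sub]
      rw [eq_sub_of_add_eq hb]
      abel
  tfae_have 3 ↔ 4 := by
    simp only [Set.eq_singleton_iff_unique_mem]
    have hΦ0 : (Φ 0, (0 : Module.Dual K V₂)) ∈ F := by rw [map_zero]; exact hF0
    refine ⟨fun ⟨h, hs⟩ => ⟨⟨⟨⟨0, 0, by simp [← Prod.zero_eq_mk], hΦ0⟩,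
      by simpa [← Prod.zero_eq_mk] using h0⟩, ?_⟩, ?_⟩,
      fun ⟨h, hs⟩ => ⟨⟨⟨⟨0, 0, by simp [← Prod.zero_eq_mk], hΦ0⟩, h0⟩, ?_⟩, ?_⟩⟩
    · rintro _ ⟨⟨v, β, rfl, hvF⟩, hE⟩
      have := h.2 _ ⟨⟨v, β, rfl, hvF⟩, hE⟩
      obtain ⟨rfl, h₂⟩ := Prod.ext_iff.1 this
      exact Prod.ext rfl (by simpa using h₂)
    · rintro ⟨a, α⟩
      obtain ⟨_, ⟨v, β, rfl, hvF⟩, ⟨u, γ⟩, hy, hz⟩ := hs (a, α - σ a)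
      obtain ⟨h₁, h₂⟩ := Prod.ext_iff.1 hz
      simp only [Prod.fst_add, Prod.snd_add] at h₁ h₂
      refine ⟨_, ⟨v, β, rfl, hvF⟩, (u, γ + σ u), by simpa using hy, Prod.ext h₁ ?_⟩
      simp only [Prod.snd_add]
      rw [eq_add_of_sub_eq h₂, h₁, map_add]
      abel
    · rintro _ ⟨⟨v, β, rfl, hvF⟩, hE⟩
      have := h.2 (v, Φ.dualMap β) ⟨⟨v, β, rfl, hvF⟩, hE⟩
      obtain ⟨rfl, h₂⟩ := Prod.ext_iff.1 this
      exact Prod.ext rfl (by simpa using h₂)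
    · rintro ⟨a, α⟩
      obtain ⟨_, ⟨v, β, rfl, hvF⟩, ⟨u, γ⟩, hy, hz⟩ := hs (a, α + σ a)
      obtain ⟨h₁, h₂⟩ := Prod.ext_iff.1 hz
      simp only [Prod.fst_add, Prod.snd_add] at h₁ h₂
      refine ⟨_, ⟨v, β, rfl, hvF⟩, _, hy, Prod.ext h₁ ?_⟩
      simp only [Prod.snd_add]
      rw [eq_sub_of_add_eq h₂, h₁, map_add]
      abel
  tfae_finish
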